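/- Let k, l, a, b ∈ ℝ with l ≠ k and l ≠ −k, and set A(x,y,t) = x − 2ly + 12l²t − 4abkt·i/(k+l)². Let Ω ⊆ ℝ³ be the open set where 1 + (2lA)² ≠ 0. Define on Ω: u = 4li/(1 + (2lA)²), Ψ₁ = b e^{i(kx + k²y)} (−2Al(k+l) + i(k−l))/(2lA(k−l) + i(k−l)), Φ₁ = a e^{−i(kx + k²y)} (2lA(k²−l²) + (k−l)² i)/(−2lA(l+k)² + i(k+l)²), and w = −8l² i/(1 + (2lA)²). Then w_x = u_y and (u, Ψ₁, Φ₁, w) is a solution on Ω of the mKPIESCS (α = i) of degree 1. (One-lump solution of the mKPI equation with self-consistent sources, Example 2.) -/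

import Mathlib

noncomputable section

/-- Complex-valued functions of `(x, y, t) ∈ ℝ³`. -/
abbrev F3 := ℝ → ℝ → ℝ → ℂ

/-- partial derivative in `x`. -/
def px (f : F3) : F3 := fun (x y t : ℝ) => deriv (fun s => f s y t) x

/-- partial derivative in `y`. -/
def py (f : F3) : F3 := fun (x y t : ℝ) => deriv (fun s => f x s t) y

/-- partial derivative in `t`. -/
def pt (f : F3) : F3 := fun (x y t : ℝ) => deriv (fun s => f x y s) t

/-- pointwise product. -/
def fmul (p q : F3) : F3 := fun (x y t : ℝ) => p x y t * q x y t

/-- `C^∞` smoothness on a subset of `ℝ³`. -/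
def Smooth3On (Ω : Set (ℝ × ℝ × ℝ)) (f : F3) : Prop :=
  ContDiffOn ℝ (⊤ : ℕ∞) (fun p : ℝ × ℝ × ℝ => f p.1 p.2.1 p.2.2) Ω

/-- `(u, Ψ₁, …, Ψ_N, Φ₁, …, Φ_N, w)` is a solution on `Ω` of the mKP equation with
self-consistent sources (mKPESCS) of degree `N` (for the constant `α`);
`w` plays the role of the antiderivative `D⁻¹(u_y)`. -/
def IsMKPESCSOn (α : ℂ) (Ω : Set (ℝ × ℝ × ℝ)) (N : ℕ)
    (u : F3) (Ψ Φ : Fin N → F3) (w : F3) : Prop :=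
  Smooth3On Ω u ∧ Smooth3On Ω w ∧ (∀ i, Smooth3On Ω (Ψ i)) ∧
  (∀ i, Smooth3On Ω (Φ i)) ∧
  (∀ x y t, (x, y, t) ∈ Ω → px w x y t = py u x y t) ∧
  (∀ x y t, (x, y, t) ∈ Ω →
    pt u x y t + px (px (px u)) x y t + 3 * α ^ 2 * py w x y t
      - 6 * α * w x y t * px u x y t - 6 * (u x y t) ^ 2 * px u x y t
      + 4 * ∑ i, px (fmul (Ψ i) (Φ i)) x y t = 0) ∧
  (∀ i, ∀ x y t, (x, y, t) ∈ Ω → α * py (Ψ i) x y t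
      = px (px (Ψ i)) x y t - 2 * u x y t * px (Ψ i) x y t) ∧
  (∀ i, ∀ x y t, (x, y, t) ∈ Ω → α * py (Φ i) x y t
      = -(px (px (Φ i)) x y t) - 2 * u x y t * px (Φ i) x y t)

lemma px_eq_of_eqOn {Ω : Set (ℝ × ℝ × ℝ)} (hΩ : IsOpen Ω) {f g g' : F3}
    (hfg : ∀ x y t, (x, y, t) ∈ Ω → f x y t = g x y t)
    (hg : ∀ x y t, (x, y, t) ∈ Ω → HasDerivAt (fun s => g s y t) (g' x y t) x)
    (x y t : ℝ) (h : (x, y, t) ∈ Ω) : px f x y t = g' x y t := by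
  have hev : ∀ᶠ s in nhds x, (s, y, t) ∈ Ω :=
    (hΩ.preimage (by fun_prop : Continuous fun s : ℝ => (s, y, t))).mem_nhds h
  exact ((hg x y t h).congr_of_eventuallyEq (hev.mono fun s hs => hfg s y t hs)).deriv

lemma py_eq_of_eqOn {Ω : Set (ℝ × ℝ × ℝ)} (hΩ : IsOpen Ω) {f g g' : F3}
    (hfg : ∀ x y t, (x, y, t) ∈ Ω → f x y t = g x y t)
    (hg : ∀ x y t, (x, y, t) ∈ Ω → HasDerivAt (fun s => g x s t) (g' x y t) y)
    (x y t : ℝ) (h : (x, y, t) ∈ Ω) : py f x y t = g' x y t := by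
  have hev : ∀ᶠ s in nhds y, (x, s, t) ∈ Ω :=
    (hΩ.preimage (by fun_prop : Continuous fun s : ℝ => (x, s, t))).mem_nhds h
  exact ((hg x y t h).congr_of_eventuallyEq (hev.mono fun s hs => hfg x s t hs)).deriv

lemma pt_eq_of_eqOn {Ω : Set (ℝ × ℝ × ℝ)} (hΩ : IsOpen Ω) {f g g' : F3}
    (hfg : ∀ x y t, (x, y, t) ∈ Ω → f x y t = g x y t)
    (hg : ∀ x y t, (x, y, t) ∈ Ω → HasDerivAt (fun s => g x y s) (g' x y t) t)
    (x y t : ℝ) (h : (x, y, t) ∈ Ω) : pt f x y t = g' x y t := by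
  have hev : ∀ᶠ s in nhds t, (x, y, s) ∈ Ω :=
    (hΩ.preimage (by fun_prop : Continuous fun s : ℝ => (x, y, s))).mem_nhds h
  exact ((hg x y t h).congr_of_eventuallyEq (hev.mono fun s hs => hfg x y s hs)).deriv

lemma HasDerivAt.inv_mul_add_const {f : ℝ → ℂ} {f' : ℂ} {s : ℝ} (hf : HasDerivAt f f' s)
    (m c : ℂ) (h : m * f s + c ≠ 0) :
    HasDerivAt (fun r => (m * f r + c)⁻¹) (-(m * f') * (m * f s + c)⁻¹ ^ 2) s := by
  refine (((hf.const_mul m).add_const c).fun_inv h).congr_deriv ?_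
  rw [div_eq_mul_inv, inv_pow]

lemma hasDerivAt_ofReal (s : ℝ) : HasDerivAt (fun r : ℝ => (r : ℂ)) 1 s :=
  Complex.ofRealCLM.hasDerivAt

lemma contDiff_ofReal_comp {E : Type*} [NormedAddCommGroup E] [NormedSpace ℝ E] {f : E → ℝ}
    {n : WithTop ℕ∞} (hf : ContDiff ℝ n f) :
    ContDiff ℝ n fun p => (f p : ℂ) :=
  Complex.ofRealCLM.contDiff.comp hf

lemma ContDiffOn.div_complex {E : Type*} [NormedAddCommGroup E] [NormedSpace ℝ E]
    {f g : E → ℂ} {S : Set E} {n : WithTop ℕ∞} (hf : ContDiffOn ℝ n f S)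
    (hg : ContDiffOn ℝ n g S) (h : ∀ p ∈ S, g p ≠ 0) :
    ContDiffOn ℝ n (fun p => f p / g p) S := by
  simp only [div_eq_mul_inv]
  exact hf.mul (hg.inv h)

set_option maxHeartbeats 1000000 in
/-- **Example 2**: one-lump solution of the mKPI equation with self-consistent
sources (`α = i`) of degree 1. -/
theorem mKPIESCS_lump_solution
    (k l a b : ℝ) (hlk : l ≠ k) (hlk' : l ≠ -k)
    (A : F3)
    (hA : A = fun (x y t : ℝ) => (x : ℂ) - 2 * (l : ℂ) * (y : ℂ) + 12 * (l : ℂ) ^ 2 * (t : ℂ)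
      - 4 * (a : ℂ) * (b : ℂ) * (k : ℂ) * (t : ℂ) * Complex.I / ((k : ℂ) + (l : ℂ)) ^ 2)
    (Ω : Set (ℝ × ℝ × ℝ))
    (hΩ : Ω = {p : ℝ × ℝ × ℝ | 1 + (2 * (l : ℂ) * A p.1 p.2.1 p.2.2) ^ 2 ≠ 0})
    (u : F3) (hu : u = fun (x y t : ℝ) =>
      4 * (l : ℂ) * Complex.I / (1 + (2 * (l : ℂ) * A x y t) ^ 2))
    (Ψ₁ : F3) (hΨ₁ : Ψ₁ = fun (x y t : ℝ) =>
      (b : ℂ) * Complex.exp (Complex.I * ((k : ℂ) * (x : ℂ) + (k : ℂ) ^ 2 * (y : ℂ)))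
        * ((-2 * A x y t * (l : ℂ) * ((k : ℂ) + (l : ℂ)) + Complex.I * ((k : ℂ) - (l : ℂ)))
            / (2 * (l : ℂ) * A x y t * ((k : ℂ) - (l : ℂ)) + Complex.I * ((k : ℂ) - (l : ℂ)))))
    (Φ₁ : F3) (hΦ₁ : Φ₁ = fun (x y t : ℝ) =>
      (a : ℂ) * Complex.exp (-(Complex.I * ((k : ℂ) * (x : ℂ) + (k : ℂ) ^ 2 * (y : ℂ))))
        * ((2 * (l : ℂ) * A x y t * ((k : ℂ) ^ 2 - (l : ℂ) ^ 2)
              + ((k : ℂ) - (l : ℂ)) ^ 2 * Complex.I)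
            / (-2 * (l : ℂ) * A x y t * ((l : ℂ) + (k : ℂ)) ^ 2
              + Complex.I * ((k : ℂ) + (l : ℂ)) ^ 2)))
    (w : F3) (hw : w = fun (x y t : ℝ) =>
      -8 * (l : ℂ) ^ 2 * Complex.I / (1 + (2 * (l : ℂ) * A x y t) ^ 2)) :
    (∀ x y t, (x, y, t) ∈ Ω → px w x y t = py u x y t) ∧
    IsMKPESCSOn Complex.I Ω 1 u (fun _ => Ψ₁) (fun _ => Φ₁) w := by
  set L : ℂ := (l : ℂ) with hL
  set K : ℂ := (k : ℂ) with hK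
  have hI := Complex.I_sq
  have hKL : K - L ≠ 0 := by
    rw [hK, hL, ← Complex.ofReal_sub]
    exact Complex.ofReal_ne_zero.2 (sub_ne_zero.2 hlk.symm)
  have hKL' : K + L ≠ 0 := by
    rw [hK, hL, ← Complex.ofReal_add]
    exact Complex.ofReal_ne_zero.2 fun h => hlk' (by linarith)
  have hcx : ContDiff ℝ (⊤ : ℕ∞) fun p : ℝ × ℝ × ℝ => (p.1 : ℂ) :=
    contDiff_ofReal_comp (by fun_prop)
  have hcy : ContDiff ℝ (⊤ : ℕ∞) fun p : ℝ × ℝ × ℝ => (p.2.1 : ℂ) :=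
    contDiff_ofReal_comp (by fun_prop)
  have hct : ContDiff ℝ (⊤ : ℕ∞) fun p : ℝ × ℝ × ℝ => (p.2.2 : ℂ) :=
    contDiff_ofReal_comp (by fun_prop)
  have hAc : ContDiff ℝ (⊤ : ℕ∞) fun p : ℝ × ℝ × ℝ => A p.1 p.2.1 p.2.2 := by
    simp only [hA, div_eq_mul_inv]
    fun_prop
  have hΩo : IsOpen Ω := by
    have hc := hAc.continuous
    rw [hΩ]
    exact isOpen_ne_fun (by fun_prop) continuous_const
  set τ : ℂ := 12 * L ^ 2 - 4 * a * b * K * Complex.I / (K + L) ^ 2 with hτ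
  have hAx : ∀ x y t, HasDerivAt (fun s => A s y t) 1 x := fun x y t => by
    simp only [hA]
    exact (((hasDerivAt_ofReal x).sub_const _).add_const _).sub_const _
  have hAy : ∀ x y t, HasDerivAt (fun s => A x s t) (-(2 * L)) y := fun x y t => by
    simp only [hA]
    simpa only [mul_one] using
      ((((hasDerivAt_ofReal y).const_mul (2 * L)).const_sub (x : ℂ)).add_const _).sub_const _
  have hAt : ∀ x y t, HasDerivAt (fun s => A x y s) τ t := fun x y t => by
    have h := ((hasDerivAt_ofReal t).const_mul τ).const_add ((x : ℂ) - 2 * L * y)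
    simp only [mul_one] at h
    refine h.congr_of_eventuallyEq (.of_forall fun s => ?_)
    simp only [hA, hτ]
    ring
  have hmem : ∀ p ∈ Ω, 1 + (2 * L * A p.1 p.2.1 p.2.2) ^ 2 ≠ 0 := fun p hp => by
    rw [hΩ] at hp
    exact hp
  have hne : ∀ x y t, (x, y, t) ∈ Ω →
      2 * L * A x y t + Complex.I ≠ 0 ∧ 2 * L * A x y t + -Complex.I ≠ 0 := by
    intro x y t h
    have hmul : 1 + (2 * L * A x y t) ^ 2 ≠ 0 := hmem (x, y, t) h
    have hfac : 1 + (2 * L * A x y t) ^ 2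
        = (2 * L * A x y t + Complex.I) * (2 * L * A x y t + -Complex.I) := by
      linear_combination hI
    rw [hfac] at hmul
    exact mul_ne_zero_iff.1 hmul
  -- The reciprocals `P`, `Q` of the two linear factors of `1 + (2lA)²`.
  obtain ⟨P, hP⟩ : ∃ P : F3, P = fun x y t => (2 * L * A x y t + Complex.I)⁻¹ := ⟨_, rfl⟩
  obtain ⟨Q, hQ⟩ : ∃ Q : F3, Q = fun x y t => (2 * L * A x y t + -Complex.I)⁻¹ := ⟨_, rfl⟩
  obtain ⟨E, hE⟩ : ∃ E : F3, E = fun (x y _ : ℝ) =>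
    Complex.exp (Complex.I * (K * (x : ℂ) + K ^ 2 * (y : ℂ))) := ⟨_, rfl⟩
  obtain ⟨F, hF⟩ : ∃ F : F3, F = fun (x y _ : ℝ) =>
    Complex.exp (-(Complex.I * (K * (x : ℂ) + K ^ 2 * (y : ℂ)))) := ⟨_, rfl⟩
  have hEF : ∀ x y t, E x y t * F x y t = 1 := fun x y t => by
    simp only [hE, hF, ← Complex.exp_add, add_neg_cancel, Complex.exp_zero]
  have hPQ : ∀ x y t, (x, y, t) ∈ Ω →
      P x y t * Q x y t = Complex.I / 2 * (P x y t - Q x y t) := by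
    intro x y t h
    obtain ⟨h₁, h₂⟩ := hne x y t h
    simp only [hP, hQ]
    field_simp
    linear_combination 2 * hI
  have hPx : ∀ x y t, (x, y, t) ∈ Ω →
      HasDerivAt (fun s => P s y t) (-(2 * L * 1) * P x y t ^ 2) x := fun x y t h => by
    simpa only [hP] using (hAx x y t).inv_mul_add_const _ _ (hne x y t h).1
  have hQx : ∀ x y t, (x, y, t) ∈ Ω →
      HasDerivAt (fun s => Q s y t) (-(2 * L * 1) * Q x y t ^ 2) x := fun x y t h => by
    simpa only [hQ] using (hAx x y t).inv_mul_add_const _ _ (hne x y t h).2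
  have hPy : ∀ x y t, (x, y, t) ∈ Ω →
      HasDerivAt (fun s => P x s t) (-(2 * L * -(2 * L)) * P x y t ^ 2) y := fun x y t h => by
    simpa only [hP] using (hAy x y t).inv_mul_add_const _ _ (hne x y t h).1
  have hQy : ∀ x y t, (x, y, t) ∈ Ω →
      HasDerivAt (fun s => Q x s t) (-(2 * L * -(2 * L)) * Q x y t ^ 2) y := fun x y t h => by
    simpa only [hQ] using (hAy x y t).inv_mul_add_const _ _ (hne x y t h).2
  have hPt : ∀ x y t, (x, y, t) ∈ Ω →
      HasDerivAt (fun s => P x y s) (-(2 * L * τ) * P x y t ^ 2) t := fun x y t h => by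
    simpa only [hP] using (hAt x y t).inv_mul_add_const _ _ (hne x y t h).1
  have hQt : ∀ x y t, (x, y, t) ∈ Ω →
      HasDerivAt (fun s => Q x y s) (-(2 * L * τ) * Q x y t ^ 2) t := fun x y t h => by
    simpa only [hQ] using (hAt x y t).inv_mul_add_const _ _ (hne x y t h).2
  have hθx : ∀ x y : ℝ, HasDerivAt (fun s : ℝ => Complex.I * (K * (s : ℂ) + K ^ 2 * (y : ℂ)))
      (Complex.I * (K * 1)) x := fun x y =>
    (((hasDerivAt_ofReal x).const_mul K).add_const _).const_mul _
  have hθy : ∀ x y : ℝ, HasDerivAt (fun s : ℝ => Complex.I * (K * (x : ℂ) + K ^ 2 * (s : ℂ)))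
      (Complex.I * (K ^ 2 * 1)) y := fun x y =>
    (((hasDerivAt_ofReal y).const_mul (K ^ 2)).const_add _).const_mul _
  have hEx : ∀ x y t, HasDerivAt (fun s => E s y t) (E x y t * (Complex.I * (K * 1))) x :=
    fun x y t => by simpa only [hE] using (hθx x y).cexp
  have hEy : ∀ x y t, HasDerivAt (fun s => E x s t) (E x y t * (Complex.I * (K ^ 2 * 1))) y :=
    fun x y t => by simpa only [hE] using (hθy x y).cexp
  have hFx : ∀ x y t, HasDerivAt (fun s => F s y t) (F x y t * -(Complex.I * (K * 1))) x :=
    fun x y t => by simpa only [hF] using (hθx x y).fun_neg.cexp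
  have hFy : ∀ x y t, HasDerivAt (fun s => F x s t) (F x y t * -(Complex.I * (K ^ 2 * 1))) y :=
    fun x y t => by simpa only [hF] using (hθy x y).fun_neg.cexp
  -- Partial fraction forms.
  have hr : ∀ x y t, (x, y, t) ∈ Ω →
      (1 + (2 * L * A x y t) ^ 2)⁻¹ = Complex.I / 2 * (P x y t - Q x y t) := by
    intro x y t h
    rw [← hPQ x y t h]
    simp only [hP, hQ]
    rw [← mul_inv]
    congr 1
    linear_combination hI
  have hu' : ∀ x y t, (x, y, t) ∈ Ω → u x y t = 2 * L * (Q x y t - P x y t) := by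
    intro x y t h
    simp only [hu, div_eq_mul_inv, hr x y t h]
    linear_combination 2 * L * (P x y t - Q x y t) * hI
  have hw' : ∀ x y t, (x, y, t) ∈ Ω → w x y t = -4 * L ^ 2 * (Q x y t - P x y t) := by
    intro x y t h
    simp only [hw, div_eq_mul_inv, hr x y t h]
    linear_combination -4 * L ^ 2 * (P x y t - Q x y t) * hI
  set B : ℂ := b / (K - L) with hB
  set C : ℂ := -(a * (K - L) / (K + L) ^ 2) with hC
  have hΨ' : ∀ x y t, (x, y, t) ∈ Ω →
      Ψ₁ x y t = B * (E x y t * (-(K + L) + 2 * Complex.I * K * P x y t)) := by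
    intro x y t h
    have h₁ := (hne x y t h).1
    have h₂ : 2 * L * A x y t * (K - L) + Complex.I * (K - L)
        = (K - L) * (2 * L * A x y t + Complex.I) := by ring
    simp only [hΨ₁, hE, hP, hB, h₂, div_eq_mul_inv, mul_inv]
    linear_combination -(b * Complex.exp (Complex.I * (K * x + K ^ 2 * y)) * (K - L)⁻¹ * (K + L))
      * mul_inv_cancel₀ h₁
  have hΦ' : ∀ x y t, (x, y, t) ∈ Ω →
      Φ₁ x y t = C * (F x y t * ((K + L) + 2 * Complex.I * K * Q x y t)) := by
    intro x y t h
    have h₁ := (hne x y t h).2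
    have h₂ : -2 * L * A x y t * (L + K) ^ 2 + Complex.I * (K + L) ^ 2
        = -((K + L) ^ 2 * (2 * L * A x y t + -Complex.I)) := by ring
    simp only [hΦ₁, hF, hQ, hC, h₂]
    field_simp
    ring
  have hwx := px_eq_of_eqOn hΩo hw' fun x y t h =>
    ((hQx x y t h).fun_sub (hPx x y t h)).const_mul (-4 * L ^ 2)
  have hwy := py_eq_of_eqOn hΩo hw' fun x y t h =>
    ((hQy x y t h).fun_sub (hPy x y t h)).const_mul (-4 * L ^ 2)
  have hux := px_eq_of_eqOn hΩo hu' fun x y t h =>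
    ((hQx x y t h).fun_sub (hPx x y t h)).const_mul (2 * L)
  have huy := py_eq_of_eqOn hΩo hu' fun x y t h =>
    ((hQy x y t h).fun_sub (hPy x y t h)).const_mul (2 * L)
  have hut := pt_eq_of_eqOn hΩo hu' fun x y t h =>
    ((hQt x y t h).fun_sub (hPt x y t h)).const_mul (2 * L)
  have huxx := px_eq_of_eqOn hΩo hux fun x y t h =>
    ((((hQx x y t h).fun_pow 2).const_mul (-(2 * L * 1))).fun_sub
      (((hPx x y t h).fun_pow 2).const_mul (-(2 * L * 1)))).const_mul (2 * L)
  have huxx' : ∀ x y t, (x, y, t) ∈ Ω →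
      px (px u) x y t = 16 * L ^ 3 * (Q x y t ^ 3 - P x y t ^ 3) := by
    intro x y t h
    rw [huxx x y t h]
    norm_num
    ring
  have huxxx := px_eq_of_eqOn hΩo huxx' fun x y t h =>
    (((hQx x y t h).fun_pow 3).fun_sub ((hPx x y t h).fun_pow 3)).const_mul (16 * L ^ 3)
  have hΨx := px_eq_of_eqOn hΩo hΨ' fun x y t h =>
    ((hEx x y t).fun_mul (((hPx x y t h).const_mul (2 * Complex.I * K)).const_add
      (-(K + L)))).const_mul B
  have hΨy := py_eq_of_eqOn hΩo hΨ' fun x y t h =>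
    ((hEy x y t).fun_mul (((hPy x y t h).const_mul (2 * Complex.I * K)).const_add
      (-(K + L)))).const_mul B
  have hΨx' : ∀ x y t, (x, y, t) ∈ Ω → px Ψ₁ x y t = B * (E x y t *
      (-(Complex.I * K * (K + L)) + (-2 * K ^ 2 * P x y t
        + -4 * Complex.I * K * L * P x y t ^ 2))) := by
    intro x y t h
    rw [hΨx x y t h]
    linear_combination 2 * B * E x y t * K ^ 2 * P x y t * hI
  have hΨxx := px_eq_of_eqOn hΩo hΨx' fun x y t h =>
    ((hEx x y t).fun_mul ((((hPx x y t h).const_mul (-2 * K ^ 2)).fun_add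
      (((hPx x y t h).fun_pow 2).const_mul (-4 * Complex.I * K * L))).const_add
      (-(Complex.I * K * (K + L))))).const_mul B
  have hΦx := px_eq_of_eqOn hΩo hΦ' fun x y t h =>
    ((hFx x y t).fun_mul (((hQx x y t h).const_mul (2 * Complex.I * K)).const_add
      (K + L))).const_mul C
  have hΦy := py_eq_of_eqOn hΩo hΦ' fun x y t h =>
    ((hFy x y t).fun_mul (((hQy x y t h).const_mul (2 * Complex.I * K)).const_add
      (K + L))).const_mul C
  have hΦx' : ∀ x y t, (x, y, t) ∈ Ω → px Φ₁ x y t = C * (F x y t *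
      (-(Complex.I * K * (K + L)) + (2 * K ^ 2 * Q x y t
        + -4 * Complex.I * K * L * Q x y t ^ 2))) := by
    intro x y t h
    rw [hΦx x y t h]
    linear_combination -2 * C * F x y t * K ^ 2 * Q x y t * hI
  have hΦxx := px_eq_of_eqOn hΩo hΦx' fun x y t h =>
    ((hFx x y t).fun_mul ((((hQx x y t h).const_mul (2 * K ^ 2)).fun_add
      (((hQx x y t h).fun_pow 2).const_mul (-4 * Complex.I * K * L))).const_add
      (-(Complex.I * K * (K + L))))).const_mul C
  have hBC : B * C = -(a * b / (K + L) ^ 2) := by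
    rw [hB, hC]
    field_simp
  have hS : ∀ x y t, (x, y, t) ∈ Ω → fmul Ψ₁ Φ₁ x y t
      = a * b / (K + L) ^ 2 * ((K + L) ^ 2
        + 2 * Complex.I * K * L * (Q x y t - P x y t)) := by
    intro x y t h
    simp only [fmul, hΨ' x y t h, hΦ' x y t h]
    linear_combination
      (B * C * (-(K + L) + 2 * Complex.I * K * P x y t)
        * ((K + L) + 2 * Complex.I * K * Q x y t)) * hEF x y t
      + (-(K + L) + 2 * Complex.I * K * P x y t)
        * ((K + L) + 2 * Complex.I * K * Q x y t) * hBC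
      - a * b / (K + L) ^ 2 * (4 * K ^ 2 * P x y t * Q x y t * hI
        - 4 * K ^ 2 * hPQ x y t h)
  have hSx := px_eq_of_eqOn hΩo hS fun x y t h =>
    ((((hQx x y t h).fun_sub (hPx x y t h)).const_mul (2 * Complex.I * K * L)).const_add
      ((K + L) ^ 2)).const_mul (a * b / (K + L) ^ 2)
  have hxy : ∀ x y t, (x, y, t) ∈ Ω → px w x y t = py u x y t := by
    intro x y t h
    rw [hwx x y t h, huy x y t h]
    ring
  refine ⟨hxy, ?_, ?_, fun _ => ?_, fun _ => ?_, hxy, ?_, fun _ => ?_, fun _ => ?_⟩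
  · simp only [Smooth3On, hu]
    refine ContDiffOn.div_complex ?_ ?_ hmem <;> fun_prop
  · simp only [Smooth3On, hw]
    refine ContDiffOn.div_complex ?_ ?_ hmem <;> fun_prop
  · simp only [Smooth3On, hΨ₁]
    refine ContDiffOn.mul ?_ (ContDiffOn.div_complex ?_ ?_ fun p hp => ?_)
    iterate 3 fun_prop
    rw [← add_mul]
    exact mul_ne_zero (hne _ _ _ hp).1 hKL
  · simp only [Smooth3On, hΦ₁]
    refine ContDiffOn.mul ?_ (ContDiffOn.div_complex ?_ ?_ fun p hp => ?_)
    iterate 3 fun_prop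
    convert neg_ne_zero.2 (mul_ne_zero (pow_ne_zero 2 hKL') (hne _ _ _ hp).2) using 1
    ring
  · intro x y t h
    simp only [Finset.univ_unique, Finset.sum_const, Finset.card_singleton, one_smul]
    rw [hut x y t h, huxxx x y t h, hwy x y t h, hSx x y t h, hux x y t h, hw' x y t h,
      hu' x y t h]
    simp only [hτ, Nat.cast_ofNat, Nat.add_one_sub_one]
    linear_combination -48 * L ^ 4 * (Q x y t ^ 2 - P x y t ^ 2) * hI
      - 192 * L ^ 4 * (Q x y t ^ 2 - P x y t ^ 2) * hPQ x y t h
  · intro x y t h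
    rw [hΨy x y t h, hΨxx x y t h, hΨx' x y t h, hu' x y t h]
    simp only [Nat.cast_ofNat, Nat.add_one_sub_one, pow_one]
    linear_combination B * E x y t * ((2 * Complex.I * K ^ 3 * P x y t
      + 4 * K ^ 2 * L * P x y t ^ 2 + 8 * K * L ^ 2 * P x y t * Q x y t) * hI
      - (8 * K * L * (K + L) + 16 * Complex.I * K * L ^ 2 * P x y t) * hPQ x y t h)
  · intro x y t h
    rw [hΦy x y t h, hΦxx x y t h, hΦx' x y t h, hu' x y t h]
    simp only [Nat.cast_ofNat, Nat.add_one_sub_one, pow_one]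
    linear_combination C * F x y t * ((-2 * Complex.I * K ^ 3 * Q x y t
      + 4 * K ^ 2 * L * Q x y t ^ 2 + 8 * K * L ^ 2 * P x y t * Q x y t) * hI
      - (8 * K * L * (K + L) - 16 * Complex.I * K * L ^ 2 * Q x y t) * hPQ x y t h)

end
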